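/- arXiv:2006.09783 — 3 statements merged into one kernel-verified Lean document; each statement's English description precedes it below -/
import Mathlib

section
/- Let H be a Hall set on a set A whose total order is compatible with the degree, i.e. deg(h) < deg(h') implies h < h'. Then: (a) for every n >= 1 and Hall trees h0, h1, ..., hn in H with h1 <= h2 <= ... <= hn < h0 and such that either deg(h0) = 1, or h0 = (h', h'') with h1 >= h', the left-normed tree T = (hn, (h(n-1), (..., (h1, h0)...))) is a Hall tree, and its Hall word is the concatenation w(T) = w(hn) w(h(n-1)) ... w(h1) w(h0); (b) conversely, every Hall tree h with deg(h) >= 2 arises in this way: there exist n >= 1 and Hall trees h0, h1 <= h2 <= ... <= hn < h0 in H satisfying the conditions of (a) such that h = (hn, (h(n-1), (..., (h1, h0)...))). Consequently, the Hall words of degree >= 2 are exactly the words of the form w(hn) ... w(h1) w(h0) for such data, and the corresponding Hall tree encodes the left-normed iterated Lie bracket ad(X_{w(hn)}) ... ad(X_{w(h1)}) X_{w(h0)}. -/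
namespace HallTrees

/-- The degree of a binary tree in the free magma: its number of leaves. -/
def deg {A : Type*} : FreeMagma A → ℕ
  | FreeMagma.of _ => 1
  | FreeMagma.mul h₁ h₂ => deg h₁ + deg h₂

/-- The Hall word of a binary tree: the word over `A` obtained by reading the leaves,
i.e. `w(a) = a` and `w((h₁,h₂)) = w(h₁) w(h₂)` (concatenation). -/
def word {A : Type*} : FreeMagma A → List A
  | FreeMagma.of a => [a]
  | FreeMagma.mul h₁ h₂ => word h₁ ++ word h₂

/-- The interpretation of a binary tree as an iterated Lie bracket of the generators
of the free Lie algebra over `ℝ` on `A`. -/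
noncomputable def toLie {A : Type*} : FreeMagma A → FreeLieAlgebra ℝ A
  | FreeMagma.of a => FreeLieAlgebra.of ℝ a
  | FreeMagma.mul h₁ h₂ => ⁅toLie h₁, toLie h₂⁆

/-- A Hall set on `A`: a subset `mem` of the free magma `M(A)` together with a total
order `lt` on `M(A)` satisfying the Hall conditions (i)–(iv). -/
structure HallSet (A : Type*) where
  /-- membership in the Hall set -/
  mem : FreeMagma A → Prop
  /-- the total order on the free magma -/
  lt : FreeMagma A → FreeMagma A → Prop
  lt_irrefl : ∀ h, ¬ lt h h
  lt_trans : ∀ h₁ h₂ h₃, lt h₁ h₂ → lt h₂ h₃ → lt h₁ h₃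
  lt_trichotomy : ∀ h₁ h₂, lt h₁ h₂ ∨ h₁ = h₂ ∨ lt h₂ h₁
  /-- (i) every letter is a Hall tree -/
  of_mem : ∀ a : A, mem (FreeMagma.of a)
  /-- (ii) subtrees of Hall trees are Hall trees … -/
  mem_of_mul_left : ∀ h₁ h₂, mem (FreeMagma.mul h₁ h₂) → mem h₁
  mem_of_mul_right : ∀ h₁ h₂, mem (FreeMagma.mul h₁ h₂) → mem h₂
  /-- (ii) … and `h₁ < h₂`, `h₁ < h` for a Hall tree `h = (h₁, h₂)` -/
  lt_of_mul : ∀ h₁ h₂, mem (FreeMagma.mul h₁ h₂) → lt h₁ h₂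
  lt_mul_of_mul : ∀ h₁ h₂, mem (FreeMagma.mul h₁ h₂) → lt h₁ (FreeMagma.mul h₁ h₂)
  /-- (iii) every Hall tree `(h₁, (h₂₁, h₂₂))` satisfies `h₂₁ ≤ h₁` -/
  triple : ∀ h₁ h₂₁ h₂₂, mem (FreeMagma.mul h₁ (FreeMagma.mul h₂₁ h₂₂)) → ¬ lt h₁ h₂₁
  /-- (iv) every tree satisfying the conditions of (ii) and (iii) is a Hall tree -/
  complete : ∀ h₁ h₂, mem h₁ → mem h₂ → lt h₁ h₂ → lt h₁ (FreeMagma.mul h₁ h₂) →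
    (∀ h₂₁ h₂₂, h₂ = FreeMagma.mul h₂₁ h₂₂ → ¬ lt h₁ h₂₁) →
    mem (FreeMagma.mul h₁ h₂)

/-- The left-normed tree `(hₙ, (hₙ₋₁, (…, (h₁, h₀)…)))` built from a base tree `h₀`
and the list `l = [h₁, …, hₙ]`. -/
def leftNormed {A : Type*} (h₀ : FreeMagma A) (l : List (FreeMagma A)) : FreeMagma A :=
  l.foldl (fun acc h => FreeMagma.mul h acc) h₀

/-- The hypotheses on the data `h₀, h₁ ≤ h₂ ≤ … ≤ hₙ < h₀` (with `n ≥ 1`) of the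
left-normed form of a Hall tree: all trees are Hall trees, the list `l = [h₁, …, hₙ]`
is nonempty and weakly increasing, each `hᵢ < h₀`, and either `deg h₀ = 1` or
`h₀ = (h', h'')` with `h' ≤ h₁`. -/
def ChainData {A : Type*} (H : HallSet A) (h₀ : FreeMagma A)
    (l : List (FreeMagma A)) : Prop :=
  l ≠ [] ∧
  H.mem h₀ ∧
  (∀ h ∈ l, H.mem h) ∧
  l.Chain' (fun x y => x = y ∨ H.lt x y) ∧
  (∀ h ∈ l, H.lt h h₀) ∧
  (deg h₀ = 1 ∨ ∃ h' h'', h₀ = FreeMagma.mul h' h'' ∧ ∀ h₁ ∈ l.head?, ¬ H.lt h₁ h')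

theorem deg_pos' {A : Type*} (h : FreeMagma A) : 0 < deg h := by
  induction h with
  | ih1 a => exact Nat.one_pos
  | ih2 x y hx hy => exact Nat.add_pos_left hx _

theorem leftNormed_mem {A : Type*} (H : HallSet A)
    (hdeg : ∀ h h' : FreeMagma A, deg h < deg h' → H.lt h h')
    (l : List (FreeMagma A)) :
    ∀ h₀ : FreeMagma A, ChainData H h₀ l → H.mem (leftNormed h₀ l) := by
  induction l with
  | nil => intro h₀ h; exact absurd rfl h.1
  | cons x l ih =>
    rintro h₀ ⟨-, hm, hml, hc, hlt, hd⟩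
    have hx : H.lt x h₀ := hlt x (by simp)
    have h0 : H.lt h₀ (FreeMagma.mul x h₀) :=
      hdeg _ _ (Nat.lt_add_of_pos_left (deg_pos' x))
    have hmem : H.mem (FreeMagma.mul x h₀) := by
      refine H.complete x h₀ (hml x (by simp)) hm hx (H.lt_trans _ _ _ hx h0) ?_
      rintro a b rfl
      rcases hd with hd | ⟨h', h'', he, hh⟩
      · have h1 := deg_pos' a
        have h2 := deg_pos' b
        have h3 : deg a + deg b = 1 := hd
        omega
      · injection he with e1 e2
        subst e1
        exact hh x (by simp)
    cases l with
    | nil => exact hmem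
    | cons y l =>
      refine ih (FreeMagma.mul x h₀) ⟨by simp, hmem, fun h hh => hml h (List.mem_cons_of_mem _ hh),
        hc.tail, fun h hh => H.lt_trans _ _ _ (hlt h (List.mem_cons_of_mem _ hh)) h0,
        Or.inr ⟨x, h₀, rfl, ?_⟩⟩
      intro z hz hzx
      have hz' : y = z := by simpa using hz
      subst hz'
      rcases (List.isChain_cons_cons.1 hc).1 with e | e
      · subst e; exact H.lt_irrefl _ hzx
      · exact H.lt_irrefl _ (H.lt_trans _ _ _ e hzx)

theorem leftNormed_word {A : Type*} (l : List (FreeMagma A)) :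
    ∀ h₀ : FreeMagma A,
      word (leftNormed h₀ l) = (l.reverse.map word).flatten ++ word h₀ := by
  induction l with
  | nil => intro h₀; simp [leftNormed]
  | cons x l ih =>
    intro h₀
    have h := ih (FreeMagma.mul x h₀)
    change word (leftNormed (FreeMagma.mul x h₀) l) = _
    rw [h]
    simp [word]

theorem leftNormed_toLie {A : Type*} (l : List (FreeMagma A)) :
    ∀ h₀ : FreeMagma A,
      toLie (leftNormed h₀ l) = l.foldl (fun acc h => ⁅toLie h, acc⁆) (toLie h₀) := by
  induction l with
  | nil => intro h₀; rfl
  | cons x l ih => intro h₀; exact ih (FreeMagma.mul x h₀)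

/-- **Left-normed characterization of Hall trees** (for a Hall set whose order is
compatible with the degree).
(a) For every admissible datum `h₀, h₁ ≤ … ≤ hₙ < h₀` (with `n ≥ 1`), the left-normed
tree `T = (hₙ, (…, (h₁, h₀)…))` is a Hall tree, its Hall word is the concatenation
`w(hₙ) ⋯ w(h₁) w(h₀)`, and `T` encodes the left-normed iterated Lie bracket
`ad (X_{w(hₙ)}) ⋯ ad (X_{w(h₁)}) X_{w(h₀)}`.
(b) Conversely, every Hall tree of degree at least `2` arises in this fashion. -/
theorem hall_trees_left_normed_characterization
    {A : Type*} (H : HallSet A)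
    (hdeg : ∀ h h' : FreeMagma A, deg h < deg h' → H.lt h h') :
    (∀ (h₀ : FreeMagma A) (l : List (FreeMagma A)), ChainData H h₀ l →
      H.mem (leftNormed h₀ l) ∧
      word (leftNormed h₀ l) = (l.reverse.map word).flatten ++ word h₀ ∧
      toLie (leftNormed h₀ l) = l.foldl (fun acc h => ⁅toLie h, acc⁆) (toLie h₀)) ∧
    (∀ h : FreeMagma A, H.mem h → 2 ≤ deg h →
      ∃ (h₀ : FreeMagma A) (l : List (FreeMagma A)),
        ChainData H h₀ l ∧ h = leftNormed h₀ l) := by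
  refine ⟨fun h₀ l hc => ⟨leftNormed_mem H hdeg l h₀ hc, leftNormed_word l h₀,
    leftNormed_toLie l h₀⟩, ?_⟩
  intro h hm hd
  cases h with
  | of a => exact absurd hd (by simp [deg])
  | mul x y =>
    refine ⟨y, [x], ⟨by simp, H.mem_of_mul_right _ _ hm, ?_, List.isChain_singleton _, ?_, ?_⟩, rfl⟩
    · intro h hh
      rw [List.mem_singleton.1 hh]
      exact H.mem_of_mul_left _ _ hm
    · intro h hh
      rw [List.mem_singleton.1 hh]
      exact H.lt_of_mul _ _ hm
    · cases y with
      | of a => exact Or.inl rfl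
      | mul u v =>
        refine Or.inr ⟨u, v, rfl, ?_⟩
        intro z hz
        have hz' : x = z := by simpa using hz
        subst hz'
        exact H.triple _ _ _ hm

end HallTrees
end

section
/- Let iota be a type, let L be the free Lie algebra over the real numbers on iota, and let M be a real vector space equipped with a Lie module structure over L (an action of L on M by a Lie algebra homomorphism into endomorphisms, written x . m). Then for every function f : iota -> M there exists a real-linear map phi : L -> M such that phi(X_i) = f(i) for every generator X_i (the image of i under the canonical map iota -> L), and phi([x, y]) = x . phi(y) - y . phi(x) for all x, y in L. -/
/-- The underlying space of the semidirect product of `L` with the abelian algebra `M`. -/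
def SemiProd (L M : Type*) : Type _ := L × M

namespace SemiProd

variable {L M : Type*} [LieRing L] [LieAlgebra ℝ L] [AddCommGroup M] [Module ℝ M]
  [LieRingModule L M] [LieModule ℝ L M]

instance : AddCommGroup (SemiProd L M) := inferInstanceAs (AddCommGroup (L × M))

instance : Module ℝ (SemiProd L M) := inferInstanceAs (Module ℝ (L × M))

instance : Bracket (SemiProd L M) (SemiProd L M) :=
  ⟨fun a b => ((⁅a.1, b.1⁆, ⁅a.1, b.2⁆ - ⁅b.1, a.2⁆) : L × M)⟩

theorem bracket_def (a b : SemiProd L M) :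
    ⁅a, b⁆ = ((⁅a.1, b.1⁆, ⁅a.1, b.2⁆ - ⁅b.1, a.2⁆) : L × M) := rfl

theorem add_fst (a b : SemiProd L M) : (a + b).1 = a.1 + b.1 := rfl

theorem add_snd (a b : SemiProd L M) : (a + b).2 = a.2 + b.2 := rfl

theorem smul_fst (t : ℝ) (b : SemiProd L M) : (t • b).1 = t • b.1 := rfl

theorem smul_snd (t : ℝ) (b : SemiProd L M) : (t • b).2 = t • b.2 := rfl

theorem bracket_fst (a b : SemiProd L M) : (⁅a, b⁆ : SemiProd L M).1 = ⁅a.1, b.1⁆ := rfl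

theorem bracket_snd (a b : SemiProd L M) :
    (⁅a, b⁆ : SemiProd L M).2 = ⁅a.1, b.2⁆ - ⁅b.1, a.2⁆ := rfl

instance : LieRing (SemiProd L M) where
  add_lie a b c := by
    apply Prod.ext
    · simp only [bracket_fst, add_fst, add_lie]
    · simp only [bracket_snd, add_fst, add_snd, add_lie, lie_add]; abel
  lie_add a b c := by
    apply Prod.ext
    · simp only [bracket_fst, add_fst, lie_add]
    · simp only [bracket_snd, add_fst, add_snd, add_lie, lie_add]; abel
  lie_self a := by
    apply Prod.ext
    · exact lie_self a.1
    · exact sub_self _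
  leibniz_lie a b c := by
    apply Prod.ext
    · simp only [bracket_fst, add_fst]; exact leibniz_lie _ _ _
    · simp only [bracket_fst, bracket_snd, add_snd, lie_sub, lie_lie]; abel

instance : LieAlgebra ℝ (SemiProd L M) where
  lie_smul t a b := by
    apply Prod.ext
    · simp only [bracket_fst, smul_fst, lie_smul]
    · simp only [bracket_snd, smul_fst, smul_snd, lie_smul, smul_lie, smul_sub]

/-- First projection as a Lie algebra homomorphism. -/
def fstHom : SemiProd L M →ₗ⁅ℝ⁆ L where
  toFun a := a.1
  map_add' _ _ := rfl
  map_smul' _ _ := rfl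
  map_lie' := rfl

/-- Second projection as a linear map. -/
def sndLin : SemiProd L M →ₗ[ℝ] M where
  toFun a := a.2
  map_add' _ _ := rfl
  map_smul' _ _ := rfl

end SemiProd

/-- **Well-definedness of the recursively defined map on a free Lie algebra.**
Let `L` be the free Lie algebra over `ℝ` on a type `ι`, and let `M` be a real vector
space with a Lie module structure over `L`. Then for every `f : ι → M` there is a
real-linear map `φ : L → M` with `φ (X i) = f i` on the generators and
`φ ⁅x, y⁆ = x • φ y - y • φ x` (Lie module action written with the bracket)
for all `x y : L`. -/
theorem freeLieAlgebra_exists_linearMap_bracket_rule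
    (ι : Type*) (M : Type*) [AddCommGroup M] [Module ℝ M]
    [LieRingModule (FreeLieAlgebra ℝ ι) M]
    [LieModule ℝ (FreeLieAlgebra ℝ ι) M]
    (f : ι → M) :
    ∃ φ : FreeLieAlgebra ℝ ι →ₗ[ℝ] M,
      (∀ i : ι, φ (FreeLieAlgebra.of ℝ i) = f i) ∧
      (∀ x y : FreeLieAlgebra ℝ ι, φ ⁅x, y⁆ = ⁅x, φ y⁆ - ⁅y, φ x⁆) := by
  let F : FreeLieAlgebra ℝ ι →ₗ⁅ℝ⁆ SemiProd (FreeLieAlgebra ℝ ι) M :=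
    FreeLieAlgebra.lift ℝ (fun i => ((FreeLieAlgebra.of ℝ i, f i) : FreeLieAlgebra ℝ ι × M))
  have hF : ∀ i, F (FreeLieAlgebra.of ℝ i) =
      ((FreeLieAlgebra.of ℝ i, f i) : FreeLieAlgebra ℝ ι × M) :=
    fun i => FreeLieAlgebra.lift_of_apply ..
  have h1 : SemiProd.fstHom.comp F = LieHom.id := by
    apply FreeLieAlgebra.hom_ext
    intro i
    exact congrArg Prod.fst (hF i)
  have h2 : ∀ x, (F x).1 = x := fun x => LieHom.congr_fun h1 x
  refine ⟨SemiProd.sndLin ∘ₗ (F : FreeLieAlgebra ℝ ι →ₗ[ℝ] SemiProd (FreeLieAlgebra ℝ ι) M),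
    fun i => congrArg Prod.snd (hF i), fun x y => ?_⟩
  change (F ⁅x, y⁆).2 = ⁅x, (F y).2⁆ - ⁅y, (F x).2⁆
  rw [LieHom.map_lie, SemiProd.bracket_snd, h2, h2]
end

section
/- Let n be a natural number and let P_1, ..., P_n be polynomials in the real multivariate polynomial ring R[x_1, ..., x_n] satisfying the symmetry condition pderiv_j P_i = pderiv_i P_j for all i, j in {1, ..., n} (where pderiv_i denotes the formal partial derivative with respect to x_i). Then there exists a polynomial Q in R[x_1, ..., x_n] such that pderiv_i Q = P_i for all i = 1, ..., n. -/
open MvPolynomial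

/-- The coefficients of `x_i ∂_i p`. -/
lemma coeff_X_mul_pderiv_aux {n : ℕ} (i : Fin n) (p : MvPolynomial (Fin n) ℝ)
    (m : Fin n →₀ ℕ) : coeff m (X i * pderiv i p) = (m i : ℝ) * coeff m p := by
  induction p using MvPolynomial.induction_on' with
  | monomial u a =>
    rw [X_mul_pderiv_monomial, coeff_smul, coeff_monomial]
    split_ifs with h
    · subst h; simp
    · simp
  | add p q hp hq => rw [map_add, mul_add, coeff_add, coeff_add, hp, hq, mul_add]

/-- **Polynomial Poincaré lemma.** If polynomials `P 1, ..., P n` in `ℝ[x_1, ..., x_n]`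
satisfy the symmetry condition `∂_j P_i = ∂_i P_j` for all `i, j`, then there is a
polynomial `Q` with `∂_i Q = P_i` for all `i`. -/
theorem polynomial_poincare_lemma
    (n : ℕ) (P : Fin n → MvPolynomial (Fin n) ℝ)
    (hsym : ∀ i j : Fin n, pderiv j (P i) = pderiv i (P j)) :
    ∃ Q : MvPolynomial (Fin n) ℝ, ∀ i : Fin n, pderiv i Q = P i := by
  classical
  obtain ⟨S, hS⟩ : ∃ S, S = ∑ i, X i * P i := ⟨_, rfl⟩
  have hd : ∀ j, pderiv j S = P j + ∑ i, X i * pderiv i (P j) := by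
    intro j
    rw [hS, map_sum]
    simp only [pderiv_mul, Finset.sum_add_distrib, hsym _ j]
    congr 1
    rw [Finset.sum_eq_single j]
    · simp
    · intro b _ hb
      rw [pderiv_X_of_ne hb, zero_mul]
    · simp
  obtain ⟨Q, hQ⟩ : ∃ Q : MvPolynomial (Fin n) ℝ,
      ∀ m, coeff m Q = coeff m S / ((∑ i, m i : ℕ) : ℝ) := by
    refine ⟨∑ m ∈ S.support, monomial m (coeff m S / ((∑ i, m i : ℕ) : ℝ)), fun m => ?_⟩
    simp only [coeff_sum, coeff_monomial, Finset.sum_ite_eq', mem_support_iff]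
    split_ifs with h
    · rfl
    · rw [not_not.mp h, zero_div]
  refine ⟨Q, fun j => ?_⟩
  ext m
  have h := congrArg (coeff m) (hd j)
  rw [coeff_pderiv, coeff_add, coeff_sum] at h
  simp only [coeff_X_mul_pderiv_aux, ← Finset.sum_mul] at h
  have hm : ((∑ i, (m + Finsupp.single j 1 : Fin n →₀ ℕ) i : ℕ) : ℝ) = ∑ i, (m i : ℝ) + 1 := by
    simp [Finset.sum_add_distrib, Finsupp.single_apply]
  have hpos : (∑ i, (m i : ℝ) + 1) ≠ 0 := by positivity
  rw [coeff_pderiv, hQ, hm, div_mul_eq_mul_div, h]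
  field_simp
  ring
end
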